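/- Let φ: Σ⁺ → S be a semigroup morphism to a finite semigroup S and let c ∈ φ(Σ) be such that Sc ⊊ S. Let Σ₂ = Σ ∩ φ⁻¹(c) and Σ₁ = Σ \ Σ₂, and assume Σ₁ ≠ ∅. Let B = φ(ΣΣ₁*Σ₂) ⊆ Sc, viewed as a finite alphabet, and let ψ: B⁺ → Sc be the evaluation morphism (ψ(b) = b for b ∈ B, extended by the product of Sc). If there exist a good automaton A₁ = (Q₁,Σ₁,Δ₁,ι₁,F₁,R₁,<₁) for the restriction of φ to Σ₁⁺ and a good automaton A₂ = (Q₂,B,Δ₂,ι₂,F₂,R₂,<₂) for ψ, then there exists a φ-weakly-good automaton with state set Q₂ ∪ (Q₂ × S × Q₁); moreover, if A₁ and A₂ are deterministic and complete then so is this automaton. -/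

import Mathlib

/-- A (nondeterministic) Büchi/finite-word automaton with ordered states. -/
structure Auto (A : Type) where
  Q : Type
  fin : Fintype Q
  lin : LinearOrder Q
  trans : Q → A → Q → Prop
  init : Q
  final : Set Q
  rep : Set Q

namespace Auto

variable {A : Type} (M : Auto A)

/-- The strict order on states. -/
def slt (p q : M.Q) : Prop := M.lin.lt p q

/-- `pathIn X p w q`: nonempty word `w` labels a run from `p` to `q`
with all intermediate states in `X`. -/
def pathIn (X : Set M.Q) : M.Q → List A → M.Q → Prop
  | _, [], _ => False
  | p, [a], q => M.trans p a q
  | p, a :: b :: w, q => ∃ r, r ∈ X ∧ M.trans p a r ∧ pathIn X r (b :: w) q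

/-- `L_{p,X,q}`. -/
def Lset (X : Set M.Q) (p q : M.Q) : Set (List A) := {w | M.pathIn X p w q}

/-- `↓q`. -/
def below (q : M.Q) : Set M.Q := {p | M.slt p q}

/-- `L_q = L_{q,↓q,q}`. -/
def Lq (q : M.Q) : Set (List A) := M.Lset (M.below q) q q

/-- Accepting run on a nonempty finite word: `ρ i` is the state after reading `i` letters. -/
def FinAccRun (w : List A) (ρ : Fin (w.length + 1) → M.Q) : Prop :=
  ρ 0 = M.init ∧
  (∀ i : Fin w.length, M.trans (ρ i.castSucc) (w.get i) (ρ i.succ)) ∧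
  ρ (Fin.last w.length) ∈ M.final

/-- Accepting (Büchi) run on an infinite word. -/
def InfAccRun (w : ℕ → A) (ρ : ℕ → M.Q) : Prop :=
  ρ 0 = M.init ∧ (∀ i, M.trans (ρ i) (w i) (ρ (i + 1))) ∧
  ∀ n, ∃ m, n ≤ m ∧ ρ m ∈ M.rep

/-- (G1): every finite or infinite word has exactly one accepting run. -/
def G1 : Prop :=
  (∀ w : List A, w ≠ [] → ∃! ρ : Fin (w.length + 1) → M.Q, M.FinAccRun w ρ) ∧
  (∀ w : ℕ → A, ∃! ρ : ℕ → M.Q, M.InfAccRun w ρ)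

/-- (G2): each `L_q` is mapped by `φ` to a single idempotent of `S`. -/
def G2 {S : Type} [Semigroup S] (φ : List A → S) : Prop :=
  ∀ q : M.Q, ∃ e : S, e * e = e ∧ ∀ w ∈ M.Lq q, φ w = e

/-- (G3): the initial state has no incoming transitions and is maximal. -/
def G3 : Prop :=
  (∀ p a, ¬ M.trans p a M.init) ∧ ∀ q : M.Q, q ≠ M.init → M.slt q M.init

/-- `φ`-weakly-good automaton. -/
def WeaklyGood {S : Type} [Semigroup S] (φ : List A → S) : Prop :=
  M.G1 ∧ M.G2 φ ∧ M.G3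

/-- (G4) and `φ`-goodness. -/
def Good {S : Type} [Semigroup S] (φ : List A → S) : Prop :=
  M.WeaklyGood φ ∧
  ∃ f : M.Q, M.final = {f} ∧ (∀ a q, ¬ M.trans f a q) ∧
    M.slt f M.init ∧ ∀ q : M.Q, q ≠ M.init → q ≠ f → M.slt q f

def Deterministic : Prop := ∀ p a q q', M.trans p a q → M.trans p a q' → q = q'

def Complete : Prop := ∀ p a, ∃ q, M.trans p a q

end Auto

/-- Product of a list of semigroup elements (`dflt` is a junk value for `[]`). -/
def evalList {S : Type} [Semigroup S] (dflt : S) : List S → S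
  | [] => dflt
  | x :: l => l.foldl (· * ·) x

theorem evalList_cons {S : Type} [Semigroup S] (d x : S) {w : List S} (hw : w ≠ []) :
    evalList d (x :: w) = x * evalList d w := by
  obtain ⟨y, w, rfl⟩ := List.exists_cons_of_ne_nil hw
  exact List.foldl_assoc

namespace Auto

theorem ne_nil_of_pathIn {A : Type} {M : Auto A} {X : Set M.Q} {p q : M.Q} {w : List A}
    (h : M.pathIn X p w q) : w ≠ [] := by
  rintro rfl
  exact h

section Partial

variable {A : Type} (M : Auto A)

/-- Final or initial state: the states in which a run on a possibly empty finite word may end. -/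
def Acc (q : M.Q) : Prop := q ∈ M.final ∨ q = M.init

/-- The first `m` letters of the partial word `v` are defined. -/
def Live (v : ℕ → Option A) (m : ℕ) : Prop := ∀ k < m, v k ≠ none

/-- Accepting run on the finite or infinite word read off `v` up to its first undefined letter. -/
structure StopRun (v : ℕ → Option A) (p : ℕ → M.Q) : Prop where
  zero : p 0 = M.init
  step : ∀ m a, Live v m → v m = some a → M.trans (p m) a (p (m + 1))
  halt : ∀ m, Live v m → v m = none → M.Acc (p m)
  inf : (∀ k, v k ≠ none) → ∀ n, ∃ m, n ≤ m ∧ p m ∈ M.rep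

/-- Every finite (possibly empty) or infinite word has exactly one accepting run. -/
def Unambiguous : Prop :=
  ∀ v : ℕ → Option A, (∃ p, M.StopRun v p) ∧
    ∀ p p', M.StopRun v p → M.StopRun v p' → ∀ m, Live v m → p m = p' m

theorem live_succ {v : ℕ → Option A} {m : ℕ} {a : A} (h : Live v m) (ha : v m = some a) :
    Live v (m + 1) := by
  intro k hk
  rcases Nat.lt_succ_iff_lt_or_eq.mp hk with h' | rfl
  · exact h k h'
  · simp [ha]

theorem Live.mono {v : ℕ → Option A} {m n : ℕ} (h : Live v n) (hmn : m ≤ n) : Live v m :=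
  fun k hk => h k (hk.trans_le hmn)

theorem Live.exists_eq_some {v : ℕ → Option A} {m k : ℕ} (h : Live v m) (hk : k < m) :
    ∃ a, v k = some a := Option.ne_none_iff_exists'.mp (h k hk)

theorem Live.le_of_eq_none {v : ℕ → Option A} {m k : ℕ} (h : Live v m) (hk : v k = none) :
    m ≤ k := by
  by_contra! hlt
  exact h k hlt hk

/-- Extension of a run on a finite word to a sequence of states. -/
def extend {n : ℕ} (ρ : Fin (n + 1) → M.Q) (k : ℕ) : M.Q :=
  if h : k < n + 1 then ρ ⟨k, h⟩ else M.init

variable {M}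

theorem unambiguous_of_G1 (h1 : M.G1) (h3 : ∀ p a, ¬ M.trans p a M.init) :
    M.Unambiguous := by
  intro v
  by_cases hv : ∀ k, v k ≠ none
  · choose w hw using fun k => Option.ne_none_iff_exists'.mp (hv k)
    have key : ∀ p, M.StopRun v p ↔ M.InfAccRun w p := by
      intro p
      constructor
      · intro h
        exact ⟨h.zero, fun i => h.step i _ (fun k _ => hv k) (hw i), h.inf hv⟩
      · intro h
        refine ⟨h.1, ?_, fun m _ hm => absurd hm (hv m), fun _ => h.2.2⟩
        intro m a _ ha
        obtain rfl : w m = a := by simpa [hw] using ha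
        exact h.2.1 m
    obtain ⟨ρ, hρ, hu⟩ := h1.2 w
    refine ⟨⟨ρ, (key ρ).2 hρ⟩, fun p p' hp hp' m _ => ?_⟩
    rw [hu p ((key p).1 hp), hu p' ((key p').1 hp')]
  · push Not at hv
    classical
    obtain ⟨n, hn, hlive⟩ : ∃ n, v n = none ∧ Live v n :=
      ⟨Nat.find hv, Nat.find_spec hv, fun k hk => Nat.find_min hv hk⟩
    have hend : ∀ m, Live v m → v m = none → m = n := fun m hm hm' =>
      le_antisymm (hm.le_of_eq_none hn) (hlive.le_of_eq_none hm')
    rcases Nat.eq_zero_or_pos n with rfl | hpos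
    · refine ⟨⟨fun _ => M.init, rfl, ?_, fun _ _ _ => Or.inr rfl, fun h => absurd hn (h 0)⟩, ?_⟩
      · intro m a hm ha
        have := hm.le_of_eq_none hn
        obtain rfl : m = 0 := by omega
        simp [hn] at ha
      · intro p p' hp hp' m hm
        have := hm.le_of_eq_none hn
        obtain rfl : m = 0 := by omega
        rw [hp.zero, hp'.zero]
    choose w hw using fun k : Fin n => hlive.exists_eq_some k.2
    obtain ⟨l, hl, hlw⟩ : ∃ l : List A, l.length = n ∧
        ∀ (i : ℕ) (hi : i < l.length), v i = some l[i] := by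
      refine ⟨List.ofFn w, by simp, fun i hi => ?_⟩
      have := hw ⟨i, by simpa using hi⟩
      simpa using this
    subst hl
    obtain ⟨ρ, hρ, hu⟩ := h1.1 l (List.length_pos_iff.mp hpos)
    refine ⟨⟨M.extend ρ, ?_, ?_, ?_, fun h => absurd hn (h _)⟩, ?_⟩
    · simpa [extend] using hρ.1
    · intro m a hm ha
      have hlt : m < l.length := by
        refine lt_of_le_of_ne (hm.le_of_eq_none hn) ?_
        rintro rfl
        simp [hn] at ha
      obtain rfl : l[m] = a := by simpa [hlw m hlt] using ha
      have := hρ.2.1 ⟨m, hlt⟩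
      simpa [extend, hlt, Nat.lt_succ_of_lt hlt] using this
    · intro m hm hm'
      obtain rfl := hend m hm hm'
      left
      simpa [extend, Fin.last] using hρ.2.2
    · have key : ∀ p, M.StopRun v p → M.FinAccRun l fun i => p i := by
        intro p hp
        refine ⟨hp.zero, fun i => ?_, ?_⟩
        · exact hp.step i _ (hlive.mono i.2.le) (hlw i i.2)
        · rcases hp.halt _ hlive hn with h | h
          · exact h
          · exfalso
            obtain ⟨k, hk⟩ := Nat.exists_eq_succ_of_ne_zero hpos.ne'
            have := hp.step k _ (hlive.mono (by omega)) (hlw k (by omega))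
            rw [← Nat.succ_eq_add_one, ← hk, h] at this
            exact h3 _ _ this
      intro p p' hp hp' m hm
      have h := (hu _ (key p hp)).trans (hu _ (key p' hp')).symm
      exact congrFun h ⟨m, Nat.lt_succ_of_le (hm.le_of_eq_none hn)⟩

theorem G1_of_unambiguous (h1 : M.Unambiguous) (h3 : ∀ p a, ¬ M.trans p a M.init) :
    M.G1 := by
  constructor
  · intro w hw
    have hlive : ∀ m, Live (fun k => w[k]?) m ↔ m ≤ w.length := by
      intro m
      constructor
      · intro h
        exact h.le_of_eq_none (by simp)
      · intro h k hk
        simp only [ne_eq, List.getElem?_eq_none_iff]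
        omega
    obtain ⟨⟨p, hp⟩, hu⟩ := h1 fun k => w[k]?
    refine ⟨fun i => p i, ⟨hp.zero, fun i => ?_, ?_⟩, ?_⟩
    · exact hp.step i _ ((hlive _).2 i.2.le) (by simp)
    · rcases hp.halt w.length ((hlive _).2 le_rfl) (by simp) with h | h
      · exact h
      · exfalso
        obtain ⟨k, hk⟩ := Nat.exists_eq_succ_of_ne_zero (List.length_pos_iff.mpr hw).ne'
        have := hp.step k w[k] ((hlive _).2 (by omega)) (by simp)
        rw [← Nat.succ_eq_add_one, ← hk, h] at this
        exact h3 _ _ this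
    · intro ρ hρ
      have hρ' : M.StopRun (fun k => w[k]?) (M.extend ρ) := by
        refine ⟨by simpa [extend] using hρ.1, ?_, ?_, fun h => absurd (by simp) (h w.length)⟩
        · intro m a _ ha
          obtain ⟨hlt, rfl⟩ := List.getElem?_eq_some_iff.mp ha
          have := hρ.2.1 ⟨m, hlt⟩
          simpa [extend, hlt, Nat.lt_succ_of_lt hlt] using this
        · intro m hm hm'
          have h₁ := (hlive m).1 hm
          have h₂ : w.length ≤ m := by simpa using hm'
          obtain rfl : m = w.length := by omega
          left
          simpa [extend, Fin.last] using hρ.2.2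
      funext i
      have := hu _ _ hρ' hp i ((hlive _).2 (Nat.lt_succ_iff.mp i.2))
      simpa [extend, i.2] using this
  · intro w
    obtain ⟨⟨p, hp⟩, hu⟩ := h1 fun k => some (w k)
    refine ⟨p, ⟨hp.zero, fun i => hp.step i _ (fun _ _ => by simp) rfl, hp.inf (by simp)⟩, ?_⟩
    intro ρ hρ
    funext m
    refine hu ρ p ⟨hρ.1, ?_, by simp, fun _ => hρ.2.2⟩ hp m fun _ _ => by simp
    intro m a _ ha
    obtain rfl : w m = a := by simpa using ha
    exact hρ.2.1 m

end Partial

section Segment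

variable {A S : Type} (φ : List A → S) (c : S) (v : ℕ → Option A)

open Classical in
/-- The part of `v` from position `j` on, up to the first letter of `Σ₂`. -/
noncomputable def segment (j k : ℕ) : Option {a : A // φ [a] ≠ c} :=
  if h : ∃ a, v (j + k) = some a ∧ φ [a] ≠ c then some ⟨h.choose, h.choose_spec.2⟩ else none

variable {φ c v} {j k m : ℕ} {a : A}

theorem segment_of_ne (ha : v (j + k) = some a) (hc : φ [a] ≠ c) :
    segment φ c v j k = some ⟨a, hc⟩ := by
  have h : ∃ a, v (j + k) = some a ∧ φ [a] ≠ c := ⟨a, ha, hc⟩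
  rw [segment, dif_pos h]
  have := ha.symm.trans h.choose_spec.1
  simp only [Option.some.injEq] at this ⊢
  exact Subtype.ext this.symm

theorem segment_ne_none : segment φ c v j k ≠ none ↔ ∃ a, v (j + k) = some a ∧ φ [a] ≠ c := by
  unfold segment
  split <;> simp_all

theorem live_segment : Live (segment φ c v j) m ↔
    ∀ k < m, ∃ a, v (j + k) = some a ∧ φ [a] ≠ c :=
  forall₂_congr fun _ _ => segment_ne_none

end Segment

section Parse

variable {A S : Type} [Semigroup S] (φ : List A → S) (c : S) (v : ℕ → Option A)

open Classical in
/-- Parsing of a partial word into blocks from `Σ Σ₁* Σ₂`: after `i` letters, the value is `none`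
between two blocks, and `some (s, j)` inside a block, where `s` is the image of the part of the
block already read, and `j` is the position after the first letter of the block. -/
noncomputable def parse : ℕ → Option (S × ℕ)
  | 0 => none
  | i + 1 => match parse i, v i with
    | none, some a => some (φ [a], i + 1)
    | some (s, j), some a => if φ [a] = c then none else some (s * φ [a], j)
    | _, none => none

/-- Number of blocks completed after `i` letters. -/
noncomputable def count : ℕ → ℕ
  | 0 => 0
  | i + 1 => match parse φ c v i, parse φ c v (i + 1) with
    | some _, none => count i + 1
    | _, _ => count i

/-- The letter at position `i` ends the `k`-th block, and `s` is the image of the rest of it. -/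
def BlockEnd (k i : ℕ) (s : S) : Prop :=
  Live v i ∧ count φ c v i = k ∧ (∃ j, parse φ c v i = some (s, j)) ∧ ∃ a, v i = some a ∧ φ [a] = c

open Classical in
/-- The word of block images, over the alphabet `B`. -/
noncomputable def blockWord (B : Set S) (k : ℕ) : Option {x : S // x ∈ B} :=
  if h : ∃ i s, BlockEnd φ c v k i s ∧ s * c ∈ B then
    some ⟨h.choose_spec.choose * c, h.choose_spec.choose_spec.2⟩ else none

variable {φ c v} {i j k m n : ℕ} {s : S} {a : A}

theorem parse_succ_of_none (h : parse φ c v i = none) (ha : v i = some a) :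
    parse φ c v (i + 1) = some (φ [a], i + 1) := by
  rw [parse, h, ha]

theorem parse_succ_of_ne (h : parse φ c v i = some (s, j)) (ha : v i = some a) (hc : φ [a] ≠ c) :
    parse φ c v (i + 1) = some (s * φ [a], j) := by
  rw [parse, h, ha]
  simp [hc]

theorem parse_succ_of_eq (h : parse φ c v i = some (s, j)) (ha : v i = some a) (hc : φ [a] = c) :
    parse φ c v (i + 1) = none := by
  rw [parse, h, ha]
  simp [hc]

theorem count_succ_of_none (h : parse φ c v i = none) :
    count φ c v (i + 1) = count φ c v i := by
  rw [count, h]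

theorem count_succ_of_ne (h : parse φ c v i = some (s, j)) (ha : v i = some a) (hc : φ [a] ≠ c) :
    count φ c v (i + 1) = count φ c v i := by
  rw [count, parse_succ_of_ne h ha hc, h]

theorem count_succ_of_eq (h : parse φ c v i = some (s, j)) (ha : v i = some a) (hc : φ [a] = c) :
    count φ c v (i + 1) = count φ c v i + 1 := by
  rw [count, parse_succ_of_eq h ha hc, h]

theorem count_monotone : Monotone (count φ c v) := by
  refine monotone_nat_of_le_succ fun i => ?_
  rw [count]
  split <;> omega

theorem count_le (i : ℕ) : count φ c v i ≤ i := by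
  induction i with
  | zero => simp [count]
  | succ i ih =>
    rw [count]
    split <;> omega

theorem BlockEnd.count_succ (h : BlockEnd φ c v k i s) : count φ c v (i + 1) = k + 1 := by
  obtain ⟨_, rfl, ⟨j, hj⟩, a, ha, hc⟩ := h
  exact count_succ_of_eq hj ha hc

theorem BlockEnd.parse_succ (h : BlockEnd φ c v k i s) : parse φ c v (i + 1) = none := by
  obtain ⟨_, rfl, ⟨j, hj⟩, a, ha, hc⟩ := h
  exact parse_succ_of_eq hj ha hc

theorem BlockEnd.live_succ (h : BlockEnd φ c v k i s) : Live v (i + 1) := by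
  obtain ⟨hl, rfl, ⟨j, hj⟩, a, ha, hc⟩ := h
  exact Auto.live_succ hl ha

theorem BlockEnd.le_of_count_le (h : BlockEnd φ c v k i s) (hm : count φ c v m ≤ k) : m ≤ i := by
  by_contra! hlt
  have := count_monotone (φ := φ) (c := c) (v := v) (Nat.succ_le_of_lt hlt)
  rw [Nat.succ_eq_add_one, h.count_succ] at this
  omega

theorem BlockEnd.unique {i' : ℕ} {s' : S} (h : BlockEnd φ c v k i s)
    (h' : BlockEnd φ c v k i' s') : i = i' ∧ s = s' := by
  obtain rfl : i = i' :=
    le_antisymm (h'.le_of_count_le h.2.1.le) (h.le_of_count_le h'.2.1.le)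
  refine ⟨rfl, ?_⟩
  obtain ⟨_, hj⟩ := h.2.2.1
  obtain ⟨_, hj'⟩ := h'.2.2.1
  rw [hj] at hj'
  simp_all

theorem exists_blockEnd (hm : Live v m) (hk : k < count φ c v m) :
    ∃ i s, BlockEnd φ c v k i s := by
  induction m with
  | zero => simp [count] at hk
  | succ m ih =>
    have hl := hm.mono (Nat.le_succ m)
    obtain ⟨a, ha⟩ := hm.exists_eq_some (Nat.lt_succ_self m)
    by_cases hlt : k < count φ c v m
    · exact ih hl hlt
    · cases hp : parse φ c v m with
      | none => rw [count_succ_of_none hp] at hk; omega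
      | some x =>
        obtain ⟨s, j⟩ := x
        by_cases hc : φ [a] = c
        · rw [count_succ_of_eq hp ha hc] at hk
          exact ⟨m, s, hl, by omega, ⟨j, hp⟩, a, ha, hc⟩
        · rw [count_succ_of_ne hp ha hc] at hk
          omega

/-- Inside a block, all letters from the start position on belong to `Σ₁`. -/
theorem parse_some_spec (hi : Live v i) (h : parse φ c v i = some (s, j)) :
    j ≤ i ∧ (∀ l, j ≤ l → l < i → ∃ a, v l = some a ∧ φ [a] ≠ c) ∧
    ∃ j', j = j' + 1 ∧ parse φ c v j' = none := by
  induction i generalizing s with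
  | zero => simp [parse] at h
  | succ i ih =>
    have hl := hi.mono (Nat.le_succ i)
    obtain ⟨a, ha⟩ := hi.exists_eq_some (Nat.lt_succ_self i)
    cases hp : parse φ c v i with
    | none =>
      rw [parse_succ_of_none hp ha] at h
      simp only [Option.some.injEq, Prod.mk.injEq] at h
      obtain ⟨rfl, rfl⟩ := h
      exact ⟨le_rfl, fun l _ _ => by omega, i, rfl, hp⟩
    | some x =>
      obtain ⟨s', j'⟩ := x
      by_cases hc : φ [a] = c
      · simp [parse_succ_of_eq hp ha hc] at h
      · rw [parse_succ_of_ne hp ha hc] at h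
        simp only [Option.some.injEq, Prod.mk.injEq] at h
        obtain ⟨rfl, rfl⟩ := h
        obtain ⟨h1, h2, h3⟩ := ih hl hp
        refine ⟨by omega, fun l hl₁ hl₂ => ?_, h3⟩
        rcases Nat.lt_succ_iff_lt_or_eq.mp hl₂ with h' | rfl
        · exact h2 l hl₁ h'
        · exact ⟨a, ha, hc⟩

theorem exists_word_of_parse (hφ : ∀ u v : List A, u ≠ [] → v ≠ [] → φ (u ++ v) = φ u * φ v)
    (hi : Live v i) (h : parse φ c v i = some (s, j)) :
    ∃ a u, s = φ (a :: u) ∧ ∀ y ∈ u, φ [y] ≠ c := by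
  induction i generalizing s with
  | zero => simp [parse] at h
  | succ i ih =>
    have hl := hi.mono (Nat.le_succ i)
    obtain ⟨a, ha⟩ := hi.exists_eq_some (Nat.lt_succ_self i)
    cases hp : parse φ c v i with
    | none =>
      rw [parse_succ_of_none hp ha] at h
      simp only [Option.some.injEq, Prod.mk.injEq] at h
      exact ⟨a, [], h.1.symm, by simp⟩
    | some x =>
      obtain ⟨s', j'⟩ := x
      by_cases hc : φ [a] = c
      · simp [parse_succ_of_eq hp ha hc] at h
      · rw [parse_succ_of_ne hp ha hc] at h
        simp only [Option.some.injEq, Prod.mk.injEq] at h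
        obtain ⟨rfl, rfl⟩ := h
        obtain ⟨b, u, rfl, hu⟩ := ih hl hp
        refine ⟨b, u ++ [a], ?_, ?_⟩
        · rw [← List.cons_append, hφ _ _ (by simp) (by simp)]
        · intro y hy
          rcases List.mem_append.mp hy with hy | hy
          · exact hu y hy
          · obtain rfl := List.mem_singleton.mp hy
            exact hc

/-- After a block has started, it continues as long as letters of `Σ₁` are read. -/
theorem parse_add (h : parse φ c v j = some (s, j))
    (hm : ∀ k < m, ∃ a, v (j + k) = some a ∧ φ [a] ≠ c) :
    (∃ s', parse φ c v (j + m) = some (s', j)) ∧ count φ c v (j + m) = count φ c v j := by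
  induction m with
  | zero => exact ⟨⟨s, h⟩, rfl⟩
  | succ m ih =>
    obtain ⟨⟨s', h1⟩, h2⟩ := ih fun k hk => hm k (by omega)
    obtain ⟨a, ha, hc⟩ := hm m (by omega)
    rw [← Nat.add_assoc, ← h2]
    exact ⟨⟨_, parse_succ_of_ne h1 ha hc⟩, count_succ_of_ne h1 ha hc⟩

theorem parse_ne_none (hi : parse φ c v i = none) (him : i < m) (hm : Live v m)
    (hcount : count φ c v m = count φ c v i) : parse φ c v m ≠ none := by
  induction m, him using Nat.le_induction with
  | base =>
    obtain ⟨a, ha⟩ := hm.exists_eq_some (Nat.lt_succ_self i)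
    simp [parse_succ_of_none hi ha]
  | succ m him ih =>
    have hl := hm.mono (Nat.le_succ m)
    obtain ⟨a, ha⟩ := hm.exists_eq_some (Nat.lt_succ_self m)
    have h1 := count_monotone (φ := φ) (c := c) (v := v) (Nat.le_of_succ_le him)
    have h2 := count_monotone (φ := φ) (c := c) (v := v) (Nat.le_add_right m 1)
    have hne := ih hl (by omega)
    obtain ⟨⟨s, j⟩, hp⟩ := Option.ne_none_iff_exists'.mp hne
    by_cases hc : φ [a] = c
    · rw [count_succ_of_eq hp ha hc] at hcount
      omega
    · simp [parse_succ_of_ne hp ha hc]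

variable {B : Set S}

theorem blockWord_ne_none (h : blockWord φ c v B k ≠ none) : ∃ i s, BlockEnd φ c v k i s := by
  by_contra hn
  refine h (dif_neg ?_)
  rintro ⟨i, s, hi, _⟩
  exact hn ⟨i, s, hi⟩

theorem blockWord_of_blockEnd (h : BlockEnd φ c v k i s) (hs : s * c ∈ B) :
    blockWord φ c v B k = some ⟨s * c, hs⟩ := by
  have h' : ∃ i s, BlockEnd φ c v k i s ∧ s * c ∈ B := ⟨i, s, h, hs⟩
  rw [blockWord, dif_pos h']
  have := (h'.choose_spec.choose_spec.1.unique h).2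
  simp only [this]

theorem exists_index (hk : Live (blockWord φ c v B) k) :
    ∃ i, Live v i ∧ count φ c v i = k ∧ parse φ c v i = none := by
  cases k with
  | zero => exact ⟨0, fun _ h => by omega, rfl, rfl⟩
  | succ k =>
    obtain ⟨i, s, h⟩ := blockWord_ne_none (hk k (Nat.lt_succ_self k))
    exact ⟨i + 1, h.live_succ, h.count_succ, h.parse_succ⟩

theorem live_blockWord
    (hB : ∀ k i s, BlockEnd φ c v k i s → s * c ∈ B) (hm : Live v m)
    (hk : k ≤ count φ c v m) : Live (blockWord φ c v B) k := by
  intro k' hk'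
  obtain ⟨i, s, h⟩ := exists_blockEnd hm (hk'.trans_le hk)
  simp [blockWord_of_blockEnd h (hB _ _ _ h)]

theorem blockWord_count_eq_none (hv : v m = none) :
    blockWord φ c v B (count φ c v m) = none := by
  by_contra h
  obtain ⟨i, s, h⟩ := blockWord_ne_none h
  have hle := h.le_of_count_le le_rfl
  have hge := h.1.le_of_eq_none hv
  obtain rfl : m = i := by omega
  obtain ⟨a, ha, -⟩ := h.2.2.2
  simp [hv] at ha

theorem count_eq_of_blockWord_eq_none
    (hB : ∀ k i s, BlockEnd φ c v k i s → s * c ∈ B)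
    (hk : blockWord φ c v B k = none) (hm : Live v m) (hle : k ≤ count φ c v m) :
    count φ c v m = k := by
  by_contra hne
  obtain ⟨i, s, h⟩ := exists_blockEnd hm (lt_of_le_of_ne hle (Ne.symm hne))
  simp [blockWord_of_blockEnd h (hB _ _ _ h)] at hk

end Parse

section Product

variable {A S : Type} [Semigroup S] (φ : List A → S) (c : S) {B : Set S}
  (M1 : Auto {a : A // φ [a] ≠ c}) (M2 : Auto {x : S // x ∈ B})

/-- Transitions of the block automaton: between two blocks, only the state of `M2` is stored; inside
a block, also the image of the part of the block already read and the state of `M1` are. -/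
def blockTrans : M2.Q ⊕ M2.Q × S × M1.Q → A → M2.Q ⊕ M2.Q × S × M1.Q → Prop
  | .inl _, _, .inl _ => False
  | .inl q, a, .inr x => x = (q, φ [a], M1.init)
  | .inr (q, s, p), a, .inr (q₂, s₂, p₂) =>
      q₂ = q ∧ s₂ = s * φ [a] ∧ ∃ h : φ [a] ≠ c, M1.trans p ⟨a, h⟩ p₂
  | .inr (q, s, p), a, .inl q₂ =>
      φ [a] = c ∧ M1.Acc p ∧ ∃ h : s * c ∈ B, M2.trans q ⟨s * c, h⟩ q₂

/-- The block automaton, with state set `Q₂ ∪ (Q₂ × S × Q₁)`. -/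
noncomputable def block [Fintype S] (l : LinearOrder (M2.Q ⊕ M2.Q × S × M1.Q)) : Auto A where
  Q := M2.Q ⊕ M2.Q × S × M1.Q
  fin := letI := M1.fin; letI := M2.fin; inferInstance
  lin := l
  trans := blockTrans φ c M1 M2
  init := .inl M2.init
  final := {x | Sum.elim M2.Acc (fun y => M2.Acc y.1 ∧ M1.Acc y.2.2) x}
  rep := {x | Sum.elim (· ∈ M2.rep) (fun y => M2.Acc y.1 ∧ y.2.2 ∈ M1.rep) x}

/-- The sequence of states built from a run `r` on the word of block images and from runs `P j` on
the segments starting at position `j`. -/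
noncomputable def blockRun (v : ℕ → Option A) (r : ℕ → M2.Q) (P : ℕ → ℕ → M1.Q) (i : ℕ) :
    M2.Q ⊕ M2.Q × S × M1.Q :=
  match parse φ c v i with
  | none => .inl (r (count φ c v i))
  | some (s, j) => .inr (r (count φ c v i), s, P j (i - j))

variable {φ c M1 M2} {v : ℕ → Option A} {i j k m : ℕ} {s : S} {a : A}
  {r : ℕ → M2.Q} {P : ℕ → ℕ → M1.Q}

theorem blockRun_of_none (h : parse φ c v i = none) :
    blockRun φ c M1 M2 v r P i = .inl (r (count φ c v i)) := by
  simp [blockRun, h]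

theorem blockRun_of_some (h : parse φ c v i = some (s, j)) :
    blockRun φ c M1 M2 v r P i = .inr (r (count φ c v i), s, P j (i - j)) := by
  simp [blockRun, h]

variable [Fintype S] {l : LinearOrder (M2.Q ⊕ M2.Q × S × M1.Q)}

theorem acc_block {x : M2.Q ⊕ M2.Q × S × M1.Q} : (block φ c M1 M2 l).Acc x ↔
    Sum.elim M2.Acc (fun y => M2.Acc y.1 ∧ M1.Acc y.2.2) x := by
  refine ⟨?_, Or.inl⟩
  rintro (h | rfl)
  · exact h
  · exact Or.inr rfl

theorem block_trans_init (h2 : ∀ p a, ¬ M2.trans p a M2.init) (x : M2.Q ⊕ M2.Q × S × M1.Q)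
    (a : A) : ¬ (block φ c M1 M2 l).trans x a (.inl M2.init) := by
  rcases x with q | ⟨q, s, p⟩
  · exact id
  · rintro ⟨-, -, h, ht⟩
    exact h2 _ _ ht

theorem stopRun_blockRun (hB : ∀ k i s, BlockEnd φ c v k i s → s * c ∈ B)
    (hr : M2.StopRun (blockWord φ c v B) r) (hP : ∀ j, M1.StopRun (segment φ c v j) (P j)) :
    (block φ c M1 M2 l).StopRun v (blockRun φ c M1 M2 v r P) := by
  have hacc : ∀ {m j s}, Live v m → parse φ c v m = some (s, j) →
      segment φ c v j (m - j) = none → M1.Acc (P j (m - j)) := by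
    intro m j s hm hp hs
    obtain ⟨hjm, hseg, -⟩ := parse_some_spec hm hp
    exact (hP j).halt _ (live_segment.2 fun k hk => hseg _ (by omega) (by omega)) hs
  refine ⟨?_, ?_, ?_, ?_⟩
  · rw [blockRun_of_none rfl]
    exact congrArg _ hr.zero
  · intro m a hm ha
    cases hp : parse φ c v m with
    | none =>
      rw [blockRun_of_none hp, blockRun_of_some (parse_succ_of_none hp ha), count_succ_of_none hp,
        Nat.sub_self, (hP _).zero]
      rfl
    | some x =>
      obtain ⟨s, j⟩ := x
      obtain ⟨hjm, hseg, -⟩ := parse_some_spec hm hp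
      have hadd : j + (m - j) = m := by omega
      rw [blockRun_of_some hp]
      by_cases hc : φ [a] = c
      · have he : BlockEnd φ c v (count φ c v m) m s := ⟨hm, rfl, ⟨j, hp⟩, a, ha, hc⟩
        rw [blockRun_of_none (parse_succ_of_eq hp ha hc), count_succ_of_eq hp ha hc]
        refine ⟨hc, hacc hm hp ?_, hB _ _ _ he, ?_⟩
        · by_contra hne
          obtain ⟨b, hb, hbc⟩ := segment_ne_none.1 hne
          rw [hadd, ha] at hb
          simp_all
        · exact hr.step _ _ (live_blockWord hB hm le_rfl) (blockWord_of_blockEnd he _)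
      · rw [blockRun_of_some (parse_succ_of_ne hp ha hc), count_succ_of_ne hp ha hc]
        refine ⟨rfl, rfl, hc, ?_⟩
        rw [Nat.sub_add_comm hjm]
        refine (hP j).step _ _ (live_segment.2 fun k hk => hseg _ (by omega) (by omega)) ?_
        exact segment_of_ne (by rw [hadd, ha]) hc
  · intro m hm hv
    have hr' := hr.halt _ (live_blockWord hB hm le_rfl) (blockWord_count_eq_none hv)
    rw [acc_block]
    cases hp : parse φ c v m with
    | none => rw [blockRun_of_none hp]; exact hr'
    | some x =>
      obtain ⟨s, j⟩ := x
      obtain ⟨hjm, -, -⟩ := parse_some_spec hm hp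
      rw [blockRun_of_some hp]
      refine ⟨hr', hacc hm hp ?_⟩
      by_contra hne
      obtain ⟨b, hb, hbc⟩ := segment_ne_none.1 hne
      rw [Nat.add_sub_cancel' hjm, hv] at hb
      simp at hb
  · intro hv n
    have hlive : ∀ m, Live v m := fun m k _ => hv k
    by_cases hw : ∀ k, blockWord φ c v B k ≠ none
    · obtain ⟨k, hk, hrep⟩ := hr.inf hw (n + 1)
      obtain ⟨i, -, rfl, hi⟩ := exists_index (φ := φ) (v := v) (B := B) (k := k) fun k' _ => hw k'
      refine ⟨i, ?_, ?_⟩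
      · have := count_le (φ := φ) (c := c) (v := v) i
        omega
      · rw [blockRun_of_none hi]
        exact hrep
    · push Not at hw
      classical
      obtain ⟨k, hk, hkl⟩ : ∃ k, blockWord φ c v B k = none ∧ Live (blockWord φ c v B) k :=
        ⟨Nat.find hw, Nat.find_spec hw, fun k hk => Nat.find_min hw hk⟩
      obtain ⟨i, hil, rfl, hi⟩ := exists_index hkl
      obtain ⟨a, ha⟩ := Option.ne_none_iff_exists'.mp (hv i)
      have hi' := parse_succ_of_none hi ha
      have hseg : ∀ m, Live (segment φ c v (i + 1)) m := by
        intro m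
        induction m with
        | zero => intro k hk; omega
        | succ m ih =>
          obtain ⟨⟨s, hs⟩, hcount⟩ := parse_add hi' (live_segment.1 ih)
          obtain ⟨b, hb⟩ := Option.ne_none_iff_exists'.mp (hv (i + 1 + m))
          have hbc : φ [b] ≠ c := by
            intro hbc
            have he : BlockEnd φ c v (count φ c v i) (i + 1 + m) s :=
              ⟨hlive _, by rw [hcount, count_succ_of_none hi], ⟨_, hs⟩, b, hb, hbc⟩
            simp [blockWord_of_blockEnd he (hB _ _ _ he)] at hk
          exact live_succ ih (segment_of_ne hb hbc)
      obtain ⟨m, hm, hrep⟩ := (hP (i + 1)).inf (fun k => hseg (k + 1) k (Nat.lt_succ_self k)) n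
      obtain ⟨⟨s, hs⟩, hcount⟩ := parse_add hi' (live_segment.1 (hseg m))
      refine ⟨i + 1 + m, by omega, ?_⟩
      rw [blockRun_of_some hs, hcount, count_succ_of_none hi, Nat.add_sub_cancel_left]
      exact ⟨hr.halt _ hkl hk, hrep⟩

/-- The state of `M2` stored in a state of the block automaton. -/
def outer : M2.Q ⊕ M2.Q × S × M1.Q → M2.Q := Sum.elim id Prod.fst

/-- The state of `M1` stored in a state of the block automaton. -/
def inner : M2.Q ⊕ M2.Q × S × M1.Q → M1.Q := Sum.elim (fun _ => M1.init) fun y => y.2.2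

variable {ρ : ℕ → M2.Q ⊕ M2.Q × S × M1.Q}

theorem StopRun.eq_of_parse (h : (block φ c M1 M2 l).StopRun v ρ) (hi : Live v i) :
    (parse φ c v i = none → ρ i = .inl (outer (ρ i))) ∧
    ∀ s j, parse φ c v i = some (s, j) → ρ i = .inr (outer (ρ i), s, inner (ρ i)) := by
  induction i with
  | zero =>
    refine ⟨fun _ => ?_, fun s j hp => by simp [parse] at hp⟩
    rw [h.zero]
    rfl
  | succ i ih =>
    have hl := hi.mono (Nat.le_succ i)
    obtain ⟨a, ha⟩ := hi.exists_eq_some (Nat.lt_succ_self i)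
    have ht : blockTrans φ c M1 M2 (ρ i) a (ρ (i + 1)) := h.step i a hl ha
    cases hp : parse φ c v i with
    | none =>
      rw [parse_succ_of_none hp ha]
      rw [(ih hl).1 hp] at ht
      rcases hρ : ρ (i + 1) with q | x
      · simp [hρ, blockTrans] at ht
      · rw [hρ] at ht
        obtain rfl := ht
        simp [outer, inner]
    | some x =>
      obtain ⟨s, j⟩ := x
      rw [(ih hl).2 _ _ hp] at ht
      by_cases hc : φ [a] = c
      · rw [parse_succ_of_eq hp ha hc]
        rcases hρ : ρ (i + 1) with q | ⟨q, s', p⟩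
        · simp [outer]
        · simp [hρ, blockTrans, hc] at ht
      · rw [parse_succ_of_ne hp ha hc]
        rcases hρ : ρ (i + 1) with q | ⟨q, s', p⟩
        · simp [hρ, blockTrans, hc] at ht
        · rw [hρ] at ht
          obtain ⟨-, rfl, -⟩ := ht
          simp [outer, inner]

theorem StopRun.trans_of_none (h : (block φ c M1 M2 l).StopRun v ρ) (hi : Live v i)
    (ha : v i = some a) (hp : parse φ c v i = none) :
    outer (ρ (i + 1)) = outer (ρ i) ∧ inner (ρ (i + 1)) = M1.init := by
  have ht : blockTrans φ c M1 M2 (ρ i) a (ρ (i + 1)) := h.step i a hi ha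
  rw [(h.eq_of_parse hi).1 hp,
    (h.eq_of_parse (live_succ hi ha)).2 _ _ (parse_succ_of_none hp ha)] at ht
  simpa [blockTrans] using ht

theorem StopRun.trans_of_ne (h : (block φ c M1 M2 l).StopRun v ρ) (hi : Live v i)
    (ha : v i = some a) (hp : parse φ c v i = some (s, j)) (hc : φ [a] ≠ c) :
    outer (ρ (i + 1)) = outer (ρ i) ∧ M1.trans (inner (ρ i)) ⟨a, hc⟩ (inner (ρ (i + 1))) := by
  have ht : blockTrans φ c M1 M2 (ρ i) a (ρ (i + 1)) := h.step i a hi ha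
  rw [(h.eq_of_parse hi).2 _ _ hp,
    (h.eq_of_parse (live_succ hi ha)).2 _ _ (parse_succ_of_ne hp ha hc)] at ht
  exact ⟨ht.1, ht.2.2.2⟩

theorem StopRun.trans_of_blockEnd (h : (block φ c M1 M2 l).StopRun v ρ)
    (he : BlockEnd φ c v k i s) :
    M1.Acc (inner (ρ i)) ∧
      ∃ hs : s * c ∈ B, M2.trans (outer (ρ i)) ⟨s * c, hs⟩ (outer (ρ (i + 1))) := by
  obtain ⟨hi, -, ⟨j, hp⟩, a, ha, hc⟩ := id he
  have ht : blockTrans φ c M1 M2 (ρ i) a (ρ (i + 1)) := h.step i a hi ha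
  rw [(h.eq_of_parse hi).2 _ _ hp, (h.eq_of_parse he.live_succ).1 he.parse_succ] at ht
  exact ht.2

theorem StopRun.outer_eq (h : (block φ c M1 M2 l).StopRun v ρ) (him : i ≤ m) (hm : Live v m)
    (hcount : count φ c v m = count φ c v i) : outer (ρ m) = outer (ρ i) := by
  induction m, him using Nat.le_induction with
  | base => rfl
  | succ m him ih =>
    have hl := hm.mono (Nat.le_succ m)
    obtain ⟨a, ha⟩ := hm.exists_eq_some (Nat.lt_succ_self m)
    have h1 := count_monotone (φ := φ) (c := c) (v := v) him
    have h2 := count_monotone (φ := φ) (c := c) (v := v) (Nat.le_add_right m 1)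
    rw [← ih hl (by omega)]
    cases hp : parse φ c v m with
    | none => exact (h.trans_of_none hl ha hp).1
    | some x =>
      obtain ⟨s, j⟩ := x
      by_cases hc : φ [a] = c
      · rw [count_succ_of_eq hp ha hc] at hcount
        omega
      · exact (h.trans_of_ne hl ha hp hc).1

theorem StopRun.segment (h : (block φ c M1 M2 l).StopRun v ρ) (hj : Live v j)
    (hp : parse φ c v j = some (s, j)) :
    M1.StopRun (segment φ c v j) fun k => inner (ρ (j + k)) := by
  have hlive : ∀ {m}, Live (Auto.segment φ c v j) m → Live v (j + m) := by
    intro m hm k hk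
    rcases lt_or_ge k j with hkj | hkj
    · exact hj k hkj
    · obtain ⟨a, ha, -⟩ := live_segment.1 hm (k - j) (by omega)
      rw [Nat.add_sub_cancel' hkj] at ha
      simp [ha]
  refine ⟨?_, ?_, ?_, ?_⟩
  · obtain ⟨-, -, j', rfl, hp'⟩ := parse_some_spec hj hp
    obtain ⟨a, ha⟩ := hj.exists_eq_some (Nat.lt_succ_self j')
    exact (h.trans_of_none (hj.mono (Nat.le_succ _)) ha hp').2
  · intro m b hm hb
    obtain ⟨⟨s', hs⟩, -⟩ := parse_add hp (live_segment.1 hm)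
    obtain ⟨a, ha, hc⟩ := segment_ne_none.1 (by rw [hb]; simp)
    rw [segment_of_ne ha hc] at hb
    obtain rfl := Option.some.inj hb
    exact (h.trans_of_ne (hlive hm) ha hs hc).2
  · intro m hm hv
    obtain ⟨⟨s', hs⟩, -⟩ := parse_add hp (live_segment.1 hm)
    cases ha : v (j + m) with
    | none =>
      have hacc := acc_block.1 (h.halt _ (hlive hm) ha)
      rw [(h.eq_of_parse (hlive hm)).2 _ _ hs] at hacc
      exact hacc.2
    | some a =>
      by_cases hc : φ [a] = c
      · exact (h.trans_of_blockEnd ⟨hlive hm, rfl, ⟨_, hs⟩, a, ha, hc⟩).1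
      · simp [segment_of_ne ha hc] at hv
  · intro hv n
    have hseg : ∀ m, Live (Auto.segment φ c v j) m := fun m k _ => hv k
    have hv' : ∀ k, v k ≠ none := fun k => hlive (hseg (k + 1)) k (by omega)
    obtain ⟨m, hm, hrep⟩ := h.inf hv' (j + n)
    obtain ⟨k, rfl⟩ := Nat.exists_eq_add_of_le ((Nat.le_add_right j n).trans hm)
    obtain ⟨⟨s', hs⟩, -⟩ := parse_add hp (live_segment.1 (hseg k))
    rw [(h.eq_of_parse (hlive (hseg k))).2 _ _ hs] at hrep
    exact ⟨k, by omega, hrep.2⟩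

theorem StopRun.blockWord (hB : ∀ k i s, BlockEnd φ c v k i s → s * c ∈ B)
    (hinit : ∀ p a, ¬ M2.trans p a M2.init) (hfinal : ∀ f ∈ M2.final, ∀ a q, ¬ M2.trans f a q)
    (h : (block φ c M1 M2 l).StopRun v ρ) (hr : ∀ i, Live v i → r (count φ c v i) = outer (ρ i)) :
    M2.StopRun (blockWord φ c v B) r := by
  have hstep : ∀ {k i s}, BlockEnd φ c v k i s →
      ∃ hs : s * c ∈ B, M2.trans (r k) ⟨s * c, hs⟩ (r (k + 1)) := by
    intro k i s he
    have := (h.trans_of_blockEnd he).2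
    rwa [← hr _ he.1, ← hr _ he.live_succ, he.count_succ, he.2.1] at this
  refine ⟨?_, ?_, ?_, ?_⟩
  · have := hr 0 fun k hk => absurd hk (Nat.not_lt_zero k)
    rwa [h.zero] at this
  · intro k b hk hb
    obtain ⟨i, s, he⟩ := blockWord_ne_none (k := k) (by rw [hb]; simp)
    rw [blockWord_of_blockEnd he (hB _ _ _ he)] at hb
    obtain rfl := Option.some.inj hb
    exact (hstep he).2
  · intro k hk hb
    obtain ⟨i, hi, rfl, hp⟩ := exists_index hk
    have main : ∀ m, i < m → Live v m → count φ c v m = count φ c v i →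
        ∃ s p, ρ m = .inr (r (count φ c v i), s, p) := by
      intro m him hm hcount
      obtain ⟨⟨s, j⟩, hs⟩ := Option.ne_none_iff_exists'.mp (parse_ne_none hp him hm hcount)
      refine ⟨s, inner (ρ m), ?_⟩
      rw [← hcount, hr _ hm]
      exact (h.eq_of_parse hm).2 _ _ hs
    by_cases hv : ∀ k, v k ≠ none
    · have hlive : ∀ m, Live v m := fun m k _ => hv k
      obtain ⟨m, him, hrep⟩ := h.inf hv (i + 1)
      obtain ⟨s, p, hρ⟩ := main m (by omega) (hlive m) <|
        count_eq_of_blockWord_eq_none hB hb (hlive m) (count_monotone (by omega))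
      rw [hρ] at hrep
      exact hrep.1
    · push Not at hv
      classical
      obtain ⟨m, hm, hml⟩ : ∃ m, v m = none ∧ Live v m :=
        ⟨Nat.find hv, Nat.find_spec hv, fun k hk => Nat.find_min hv hk⟩
      have him := hi.le_of_eq_none hm
      have hcount := count_eq_of_blockWord_eq_none hB hb hml (count_monotone him)
      have hacc := acc_block.1 (h.halt m hml hm)
      rcases him.lt_or_eq with him | rfl
      · obtain ⟨s, p, hρ⟩ := main m him hml hcount
        rw [hρ] at hacc
        exact hacc.1
      · rw [(h.eq_of_parse hi).1 hp, ← hr _ hi] at hacc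
        exact hacc
  · intro hw n
    have hv : ∀ k, v k ≠ none := fun k hk => hw _ (blockWord_count_eq_none hk)
    have hlive : ∀ m, Live v m := fun m k _ => hv k
    obtain ⟨i, -, hi, -⟩ := exists_index (φ := φ) (v := v) (B := B) (k := n + 1) fun k' _ => hw k'
    obtain ⟨m, him, hrep⟩ := h.inf hv i
    have hcount : n + 1 ≤ count φ c v m := hi ▸ count_monotone him
    refine ⟨count φ c v m, by omega, ?_⟩
    cases hp : parse φ c v m with
    | none =>
      rw [(h.eq_of_parse (hlive m)).1 hp, ← hr _ (hlive m)] at hrep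
      exact hrep
    | some x =>
      rw [(h.eq_of_parse (hlive m)).2 _ _ hp, ← hr _ (hlive m)] at hrep
      exfalso
      rcases hrep.1 with hf | hf
      · obtain ⟨_, _, he⟩ := blockWord_ne_none (hw (count φ c v m))
        exact hfinal _ hf _ _ (hstep he).2
      · obtain ⟨k, hk⟩ := Nat.exists_eq_add_of_le' ((Nat.le_add_left 1 n).trans hcount)
        obtain ⟨_, _, he⟩ := blockWord_ne_none (hw k)
        have := (hstep he).2
        simp only [hk] at hf
        rw [hf] at this
        exact hinit _ _ this

theorem unambiguous_block (hB : ∀ v k i s, BlockEnd φ c v k i s → s * c ∈ B)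
    (h1 : M1.Unambiguous) (h2 : M2.Unambiguous)
    (hinit : ∀ p a, ¬ M2.trans p a M2.init) (hfinal : ∀ f ∈ M2.final, ∀ a q, ¬ M2.trans f a q) :
    (block φ c M1 M2 l).Unambiguous := by
  intro v
  obtain ⟨r, hr⟩ := (h2 (Auto.blockWord φ c v B)).1
  choose P hP using fun j => (h1 (Auto.segment φ c v j)).1
  suffices key : ∀ ρ, (block φ c M1 M2 l).StopRun v ρ → ∀ m, Live v m →
      ρ m = blockRun φ c M1 M2 v r P m from
    ⟨⟨_, stopRun_blockRun (hB v) hr hP⟩, fun ρ ρ' h h' m hm =>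
      (key ρ h m hm).trans (key ρ' h' m hm).symm⟩
  intro ρ h m hm
  have houter : outer (ρ m) = r (count φ c v m) := by
    classical
    let r' : ℕ → M2.Q := fun k =>
      if hk : ∃ i, Live v i ∧ count φ c v i = k then outer (ρ hk.choose) else M2.init
    have hr' : ∀ i, Live v i → r' (count φ c v i) = outer (ρ i) := by
      intro i hi
      have hk : ∃ i', Live v i' ∧ count φ c v i' = count φ c v i := ⟨i, hi, rfl⟩
      simp only [r', dif_pos hk]
      obtain ⟨hl, hc⟩ := hk.choose_spec
      rcases le_total hk.choose i with hle | hle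
      · exact (h.outer_eq hle hi hc.symm).symm
      · exact h.outer_eq hle hl hc
    rw [← hr' m hm]
    exact (h2 _).2 _ _ (h.blockWord (hB v) hinit hfinal hr') hr _ (live_blockWord (hB v) hm le_rfl)
  cases hp : parse φ c v m with
  | none => rw [blockRun_of_none hp, (h.eq_of_parse hm).1 hp, houter]
  | some x =>
    obtain ⟨s, j⟩ := x
    obtain ⟨hjm, hseg, j', rfl, hj'⟩ := parse_some_spec hm hp
    obtain ⟨a, ha⟩ := hm.exists_eq_some (Nat.lt_of_succ_le hjm)
    have hrun := h.segment (hm.mono hjm) (parse_succ_of_none hj' ha)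
    have hinner := (h1 _).2 _ _ hrun (hP _) (m - (j' + 1))
      (live_segment.2 fun k hk => hseg _ (by omega) (by omega))
    rw [Nat.add_sub_cancel' hjm] at hinner
    rw [blockRun_of_some hp, (h.eq_of_parse hm).2 _ _ hp, houter, hinner]

theorem exists_path_of_block_inl (hφ : ∀ u v : List A, u ≠ [] → v ≠ [] → φ (u ++ v) = φ u * φ v)
    (hl : ∀ q q', l.lt (.inl q) (.inl q') → M2.lin.lt q q') {q : M2.Q} {w : List A}
    {x : M2.Q ⊕ M2.Q × S × M1.Q}
    (h : (block φ c M1 M2 l).pathIn ((block φ c M1 M2 l).below (.inl q)) x w (.inl q)) :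
    ∃ u : List {x : S // x ∈ B}, M2.pathIn (M2.below q) (outer x) u q ∧
      Sum.elim (fun _ => φ w) (fun y => y.2.1 * φ w) x = evalList c (u.map Subtype.val) := by
  induction w generalizing x with
  | nil => exact h.elim
  | cons a w ih =>
    have hcons : w ≠ [] → φ (a :: w) = φ [a] * φ w := fun hw => hφ [a] w (by simp) hw
    cases w with
    | nil =>
      rcases x with q₁ | ⟨q₁, s, p⟩
      · exact h.elim
      · obtain ⟨hc, -, hs, ht⟩ := h
        exact ⟨[⟨s * c, hs⟩], ht, by simp [evalList, hc]⟩
    | cons b w =>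
      obtain ⟨y, hy, ht, h⟩ := h
      obtain ⟨u, hu, heq⟩ := ih h
      have hcons := hcons (by simp)
      rcases x with q₁ | ⟨q₁, s, p⟩ <;> rcases y with q₂ | ⟨q₂, s₂, p₂⟩
      · exact ht.elim
      · obtain ⟨rfl, rfl, rfl⟩ : q₂ = q₁ ∧ s₂ = φ [a] ∧ p₂ = M1.init := by
          simpa [block, blockTrans] using ht
        exact ⟨u, hu, hcons.trans heq⟩
      · obtain ⟨hc, -, hs, ht⟩ := ht
        have hne := ne_nil_of_pathIn hu
        obtain ⟨z, u, rfl⟩ := List.exists_cons_of_ne_nil hne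
        refine ⟨⟨s * c, hs⟩ :: z :: u, ⟨q₂, hl _ _ hy, ht, hu⟩, ?_⟩
        rw [List.map_cons, evalList_cons _ _ (by simp), ← heq]
        simp only [Sum.elim_inr, Sum.elim_inl, hcons, hc, mul_assoc]
      · obtain ⟨rfl, rfl, -⟩ := ht
        refine ⟨u, hu, ?_⟩
        rw [← heq]
        simp only [Sum.elim_inr, hcons, mul_assoc]

theorem exists_path_of_block_inr (hφ : ∀ u v : List A, u ≠ [] → v ≠ [] → φ (u ++ v) = φ u * φ v)
    (hl₁ : ∀ q y, ¬ l.lt (.inl q) (.inr y))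
    (hl₂ : ∀ y y', l.lt (.inr y) (.inr y') → M1.lin.lt y.2.2 y'.2.2 ∨ y.2.2 = y'.2.2)
    {e : S} (he : e * e = e) {y : M2.Q × S × M1.Q}
    (hp : ∀ u ∈ M1.Lq y.2.2, φ (u.map Subtype.val) = e) {w : List A} {x : M2.Q × S × M1.Q}
    (h : (block φ c M1 M2 l).pathIn ((block φ c M1 M2 l).below (.inr y)) (.inr x) w (.inr y)) :
    ∃ u, M1.pathIn (M1.below y.2.2) x.2.2 u y.2.2 ∧
      (φ w = φ (u.map Subtype.val) ∨ φ w = φ (u.map Subtype.val) * e) := by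
  induction w generalizing x with
  | nil => exact h.elim
  | cons a w ih =>
    cases w with
    | nil =>
      obtain ⟨-, -, hc, ht⟩ := h
      exact ⟨[⟨a, hc⟩], ht, Or.inl rfl⟩
    | cons b w =>
      have hcons : φ (a :: b :: w) = φ [a] * φ (b :: w) := hφ [a] (b :: w) (by simp) (by simp)
      obtain ⟨z | z, hz, ht, h⟩ := h
      · exact (hl₁ _ _ hz).elim
      obtain ⟨u, hu, heq⟩ := ih h
      have hne := ne_nil_of_pathIn hu
      obtain ⟨-, -, hc, ht⟩ := ht
      rcases hl₂ _ _ hz with hlt | heq'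
      · obtain ⟨d, u, rfl⟩ := List.exists_cons_of_ne_nil hne
        refine ⟨⟨a, hc⟩ :: d :: u, ⟨_, hlt, ht, hu⟩, ?_⟩
        have hau : φ ((⟨a, hc⟩ :: d :: u : List {a : A // φ [a] ≠ c}).map Subtype.val) =
            φ [a] * φ ((d :: u).map Subtype.val) := hφ [a] _ (by simp) (by simp)
        rw [hau, hcons, mul_assoc]
        exact heq.imp (congrArg _) (congrArg _)
      · rw [heq'] at hu
        rw [hp u hu, he, or_self] at heq
        refine ⟨[⟨a, hc⟩], heq' ▸ ht, Or.inr ?_⟩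
        rw [hcons, heq]
        rfl

theorem block_G2 (hφ : ∀ u v : List A, u ≠ [] → v ≠ [] → φ (u ++ v) = φ u * φ v)
    (hl : ∀ q q', l.lt (.inl q) (.inl q') → M2.lin.lt q q')
    (hl₁ : ∀ q y, ¬ l.lt (.inl q) (.inr y))
    (hl₂ : ∀ y y', l.lt (.inr y) (.inr y') → M1.lin.lt y.2.2 y'.2.2 ∨ y.2.2 = y'.2.2)
    (h1 : M1.G2 fun w => φ (w.map Subtype.val))
    (h2 : M2.G2 fun w => evalList c (w.map Subtype.val)) : (block φ c M1 M2 l).G2 φ := by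
  rintro (q | y)
  · obtain ⟨e, he, hq⟩ := h2 q
    refine ⟨e, he, fun w hw => ?_⟩
    obtain ⟨u, hu, heq⟩ := exists_path_of_block_inl hφ hl hw
    exact heq.trans (hq u hu)
  · obtain ⟨e, he, hp⟩ := h1 y.2.2
    refine ⟨e, he, fun w hw => ?_⟩
    obtain ⟨u, hu, heq⟩ := exists_path_of_block_inr hφ hl₁ hl₂ he hp hw
    rw [show φ (u.map Subtype.val) = e from hp u hu, he, or_self] at heq
    exact heq

end Product

/-- There is an order on `Y ⊕ Z × X` which extends the one on `Y`, in which `Y` lies above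
`Z × X`, and which compares elements of `Z × X` first by their component in `X`. -/
theorem exists_linearOrder {X Y T : Type} (lX : LinearOrder X) (lY : LinearOrder Y) :
    ∃ l : LinearOrder (Y ⊕ Y × T × X),
      (∀ q q', l.lt (.inl q) (.inl q') ↔ lY.lt q q') ∧ (∀ y q, l.lt (.inr y) (.inl q)) ∧
      ∀ y y', l.lt (.inr y) (.inr y') → lX.lt y.2.2 y'.2.2 ∨ y.2.2 = y'.2.2 := by
  classical
  let _ : LinearOrder (Y × T) := IsWellOrder.linearOrder WellOrderingRel
  let f : Y ⊕ Y × T × X → (X ×ₗ (Y × T)) ⊕ₗ Y :=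
    Sum.elim (fun q => Sum.inrₗ q) fun y => Sum.inlₗ (toLex (y.2.2, (y.1, y.2.1)))
  have hf : Function.Injective f := by
    rintro (q | ⟨q, s, p⟩) (q' | ⟨q', s', p'⟩) h <;> simp_all [f]
  refine ⟨LinearOrder.lift' f hf, fun q q' => ?_, fun y q => ?_, fun y y' h => ?_⟩
  · change f (.inl q) < f (.inl q') ↔ _
    simp [f]
  · change f (.inr y) < f (.inl q)
    simp [f]
  · change f (.inr y) < f (.inr y') at h
    simp only [f, Sum.elim_inr, Sum.Lex.inl_lt_inl_iff, Prod.Lex.toLex_lt_toLex] at h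
    exact h.imp_right And.left

end Auto

/-- **First inductive case** `Sc ⊊ S`. Given a good automaton `M1` for the
restriction of `φ` to `Σ₁ = Σ \ φ⁻¹(c)` and a good automaton `M2` over the
alphabet `B = φ(ΣΣ₁*Σ₂) ⊆ Sc` for the evaluation morphism `ψ : B⁺ → Sc`, there
is a `φ`-weakly-good automaton with state set `Q₂ ∪ (Q₂ × S × Q₁)`, which is
deterministic and complete whenever `M1` and `M2` are. -/
theorem inductive_case_Sc {A S : Type} [Fintype A] [Semigroup S] [Fintype S]
    (φ : List A → S)
    (hφ : ∀ u v : List A, u ≠ [] → v ≠ [] → φ (u ++ v) = φ u * φ v)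
    (c : S) (hc : ∃ a : A, φ [a] = c)
    (hSc : (Set.range fun s : S => s * c) ≠ Set.univ)
    (hSigma1 : ∃ a : A, φ [a] ≠ c)
    (M1 : Auto {a : A // φ [a] ≠ c})
    (h1 : M1.Good fun w : List {a : A // φ [a] ≠ c} => φ (w.map Subtype.val))
    (M2 : Auto {x : S // x ∈ φ '' {w : List A | ∃ (a : A) (u : List A) (b : A),
        w = a :: (u ++ [b]) ∧ (∀ y ∈ u, φ [y] ≠ c) ∧ φ [b] = c}})
    (h2 : M2.Good fun l => evalList c (l.map Subtype.val)) :
    ∃ M : Auto A, M.WeaklyGood φ ∧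
      Nonempty (M.Q ≃ (M2.Q ⊕ M2.Q × S × M1.Q)) ∧
      (M1.Deterministic → M1.Complete → M2.Deterministic → M2.Complete →
        M.Deterministic ∧ M.Complete) := by
  obtain ⟨⟨hM1, hG1, hinit1, -⟩, f, hf, hout, -, -⟩ := h1
  obtain ⟨⟨hM2, hG2, hinit, hmax⟩, f', hf', hout', -, -⟩ := h2
  obtain ⟨l, hl, hl', hl₂⟩ := Auto.exists_linearOrder (T := S) M1.lin M2.lin
  have hinit' := Auto.block_trans_init (φ := φ) (c := c) (M1 := M1) (l := l) hinit
  refine ⟨Auto.block φ c M1 M2 l, ⟨?_, ?_, fun x => hinit' x, ?_⟩, ⟨Equiv.refl _⟩, ?_⟩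
  · refine Auto.G1_of_unambiguous ?_ fun x => hinit' x
    refine Auto.unambiguous_block ?_ (Auto.unambiguous_of_G1 hM1 hinit1)
      (Auto.unambiguous_of_G1 hM2 hinit) hinit ?_
    · rintro v k i s ⟨hlive, -, ⟨j, hj⟩, b, -, hb⟩
      obtain ⟨a, u, rfl, hu⟩ := Auto.exists_word_of_parse hφ hlive hj
      refine ⟨a :: (u ++ [b]), ⟨a, u, b, rfl, hu, hb⟩, ?_⟩
      rw [← List.cons_append, hφ _ _ (by simp) (by simp), hb]
    · rintro _ h
      obtain rfl : _ = f' := by simpa [hf'] using h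
      exact hout'
  · exact Auto.block_G2 hφ (fun q q' => (hl q q').1)
      (fun q y => @lt_asymm _ l.toPreorder _ _ (hl' y q)) hl₂ hG1 hG2
  · rintro (q | y) hne
    · exact (hl _ _).2 (hmax q fun h => hne (congrArg _ h))
    · exact hl' _ _
  · intro _ hcomplete
    obtain ⟨a, ha⟩ := hSigma1
    obtain ⟨q, hq⟩ := hcomplete f ⟨a, ha⟩
    exact (hout _ _ hq).elim
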